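/- arXiv:2111.03029 — 17 statements merged into one kernel-verified Lean document; each statement's English description precedes it below -/
import Mathlib

section
/- Pearl's instrumental inequality (first form): for every classical instrumental model with binary observed variables, the observed conditional distribution satisfies p(A=j, B=0 | X=0) + p(A=j, B=1 | X=1) ≤ 1 for each j ∈ {0,1}. -/
/-- Pearl's instrumental inequality (first form): for every classical instrumental
model with binary observed variables, the observed conditional distribution
satisfies `p(A=j, B=0 | X=0) + p(A=j, B=1 | X=1) ≤ 1` for each `j ∈ {0,1}`. -/
theorem pearl_instrumental_inequality_first_form
    {Λ : Type*} [Fintype Λ]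
    (μ : Λ → ℝ) (hμ0 : ∀ l, 0 ≤ μ l) (hμ1 : ∑ l, μ l = 1)
    (pA : Fin 2 → Fin 2 → Λ → ℝ)
    (hA0 : ∀ a x l, 0 ≤ pA a x l) (hA1 : ∀ x l, ∑ a, pA a x l = 1)
    (pB : Fin 2 → Fin 2 → Λ → ℝ)
    (hB0 : ∀ b a l, 0 ≤ pB b a l) (hB1 : ∀ a l, ∑ b, pB b a l = 1)
    (p : Fin 2 → Fin 2 → Fin 2 → ℝ)
    (hp : ∀ a b x, p a b x = ∑ l, μ l * pA a x l * pB b a l)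
    (j : Fin 2) :
    p j 0 0 + p j 1 1 ≤ 1 := by
  have hA (x l) : pA j x l ≤ 1 :=
    (hA1 x l) ▸ Finset.single_le_sum (fun a _ => hA0 a x l) (Finset.mem_univ j)
  rw [hp, hp, ← Finset.sum_add_distrib, ← hμ1]
  refine Finset.sum_le_sum fun l _ => ?_
  have hB := hB1 j l
  rw [Fin.sum_univ_two] at hB
  calc μ l * pA j 0 l * pB 0 j l + μ l * pA j 1 l * pB 1 j l
      = μ l * (pA j 0 l * pB 0 j l + pA j 1 l * pB 1 j l) := by ring
    _ ≤ μ l * (1 * pB 0 j l + 1 * pB 1 j l) :=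
        mul_le_mul_of_nonneg_left
          (add_le_add (mul_le_mul_of_nonneg_right (hA 0 l) (hB0 0 j l))
            (mul_le_mul_of_nonneg_right (hA 1 l) (hB0 1 j l))) (hμ0 l)
    _ = μ l := by rw [one_mul, one_mul, hB, mul_one]
end

section
/- Pearl's instrumental inequality (second form): for every classical instrumental model with binary observed variables, the observed conditional distribution satisfies p(A=j, B=0 | X=1) + p(A=j, B=1 | X=0) ≤ 1 for each j ∈ {0,1}. -/
/-- Pearl's instrumental inequality (second form): for every classical instrumental
model with binary observed variables, the observed conditional distribution
satisfies `p(A=j, B=0 | X=1) + p(A=j, B=1 | X=0) ≤ 1` for each `j ∈ {0,1}`. -/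
theorem pearl_instrumental_inequality_second_form
    {Λ : Type*} [Fintype Λ]
    (μ : Λ → ℝ) (hμ0 : ∀ l, 0 ≤ μ l) (hμ1 : ∑ l, μ l = 1)
    (pA : Fin 2 → Fin 2 → Λ → ℝ)
    (hA0 : ∀ a x l, 0 ≤ pA a x l) (hA1 : ∀ x l, ∑ a, pA a x l = 1)
    (pB : Fin 2 → Fin 2 → Λ → ℝ)
    (hB0 : ∀ b a l, 0 ≤ pB b a l) (hB1 : ∀ a l, ∑ b, pB b a l = 1)
    (p : Fin 2 → Fin 2 → Fin 2 → ℝ)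
    (hp : ∀ a b x, p a b x = ∑ l, μ l * pA a x l * pB b a l)
    (j : Fin 2) :
    p j 0 1 + p j 1 0 ≤ 1 := by
  have hA : ∀ x l, pA j x l ≤ 1 := fun x l =>
    hA1 x l ▸ Finset.single_le_sum (f := fun a => pA a x l) (fun a _ => hA0 a x l)
      (Finset.mem_univ j)
  rw [hp, hp, ← Finset.sum_add_distrib, ← hμ1]
  refine Finset.sum_le_sum fun l _ => ?_
  have hB := hB1 j l
  rw [Fin.sum_univ_two] at hB
  calc μ l * pA j 1 l * pB 0 j l + μ l * pA j 0 l * pB 1 j l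
      = μ l * (pA j 1 l * pB 0 j l + pA j 0 l * pB 1 j l) := by ring
    _ ≤ μ l * (pB 0 j l + pB 1 j l) :=
        mul_le_mul_of_nonneg_left
          (add_le_add (mul_le_of_le_one_left (hB0 0 j l) (hA 1 l))
            (mul_le_of_le_one_left (hB0 1 j l) (hA 0 l))) (hμ0 l)
    _ = μ l := by rw [hB, mul_one]
end

section
/- Balke–Pearl causal bound: for every classical instrumental model with binary observed variables, the average causal effect satisfies ACE_{A→B} ≥ 2·p(0,0|0) + p(1,1|0) + p(0,1|1) + p(1,1|1) − 2, where p(a,b|x) denotes the observed conditional distribution of the model. -/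
/-- The bound for a fixed value of the latent variable: `u` and `v` are the probabilities of `a = 0`
given `x = 0` and `x = 1`, `s` is that of `b = 0` given `a = 0` and `r` that of `b = 1` given
`a = 1`. -/
theorem instrumental_response_bound {u v s r : ℝ} (hu0 : 0 ≤ u) (hu1 : u ≤ 1) (hv0 : 0 ≤ v)
    (hv1 : v ≤ 1) (hs0 : 0 ≤ s) (hs1 : s ≤ 1) (hr0 : 0 ≤ r) (hr1 : r ≤ 1) :
    2 * (u * s) + (1 - u) * r + v * (1 - s) + (1 - v) * r - 2 ≤ r - (1 - s) := by
  have h : 0 ≤ u * (v * r + (1 - v) * (1 - s)) +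
      (1 - u) * (v * (2 * s) + (1 - v) * (s + (1 - r))) := by
    rw [← sub_nonneg] at hu1 hv1 hs1 hr1
    positivity
  linarith

/-- Balke–Pearl causal bound: for every classical instrumental model with binary
observed variables, the average causal effect satisfies
`ACE_{A→B} ≥ 2 p(0,0|0) + p(1,1|0) + p(0,1|1) + p(1,1|1) − 2`. -/
theorem balke_pearl_causal_bound
    {Λ : Type*} [Fintype Λ]
    (μ : Λ → ℝ) (hμ0 : ∀ l, 0 ≤ μ l) (hμ1 : ∑ l, μ l = 1)
    (pA : Fin 2 → Fin 2 → Λ → ℝ)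
    (hA0 : ∀ a x l, 0 ≤ pA a x l) (hA1 : ∀ x l, ∑ a, pA a x l = 1)
    (pB : Fin 2 → Fin 2 → Λ → ℝ)
    (hB0 : ∀ b a l, 0 ≤ pB b a l) (hB1 : ∀ a l, ∑ b, pB b a l = 1)
    (p : Fin 2 → Fin 2 → Fin 2 → ℝ)
    (hp : ∀ a b x, p a b x = ∑ l, μ l * pA a x l * pB b a l)
    (pdo : Fin 2 → Fin 2 → ℝ)
    (hdo : ∀ b a, pdo b a = ∑ l, μ l * pB b a l)
    (ACE : ℝ)
    (hACE : ACE = Finset.univ.sup' Finset.univ_nonempty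
      (fun t : Fin 2 × Fin 2 × Fin 2 => |pdo t.2.2 t.1 - pdo t.2.2 t.2.1|)) :
    2 * p 0 0 0 + p 1 1 0 + p 0 1 1 + p 1 1 1 - 2 ≤ ACE := by
  have hle : pdo 1 1 - pdo 1 0 ≤ ACE := by
    rw [hACE]
    exact (le_abs_self _).trans (Finset.le_sup'
      (fun t : Fin 2 × Fin 2 × Fin 2 => |pdo t.2.2 t.1 - pdo t.2.2 t.2.1|)
      (Finset.mem_univ (1, 0, 1)))
  refine le_trans ?_ hle
  have hsum : 2 * p 0 0 0 + p 1 1 0 + p 0 1 1 + p 1 1 1 - 2 =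
      ∑ l, μ l * (2 * (pA 0 0 l * pB 0 0 l) + pA 1 0 l * pB 1 1 l + pA 0 1 l * pB 1 0 l +
        pA 1 1 l * pB 1 1 l - 2) := by
    simp only [mul_sub, mul_add, Finset.sum_add_distrib, Finset.sum_sub_distrib,
      ← Finset.sum_mul, hμ1, hp, Finset.mul_sum]
    simp only [mul_assoc, mul_left_comm, one_mul]
  rw [hsum, hdo, hdo, ← Finset.sum_sub_distrib]
  refine Finset.sum_le_sum fun l _ => ?_
  rw [← mul_sub]
  refine mul_le_mul_of_nonneg_left ?_ (hμ0 l)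
  have hx0 := hA1 0 l
  have hx1 := hA1 1 l
  have ha0 := hB1 0 l
  have ha1 := hB1 1 l
  rw [Fin.sum_univ_two] at hx0 hx1 ha0 ha1
  rw [eq_sub_of_add_eq' hx0, eq_sub_of_add_eq' hx1, eq_sub_of_add_eq' ha0]
  exact instrumental_response_bound (hA0 0 0 l) (by linarith [hA0 1 0 l]) (hA0 0 1 l)
    (by linarith [hA0 1 1 l]) (hB0 0 0 l) (by linarith [hB0 1 0 l]) (hB0 1 1 l)
    (by linarith [hB0 0 1 l])
end

section
/- Lower bound of Lemma 1 (adapted instrumental inequality): for every measurement-dependent instrumental model with binary observed variables, if the observed distribution violates Pearl's inequality by α, i.e. p(0,0|0) + p(0,1|1) = 1 + α with α > 0, then the measurement dependence satisfies M_{X:Λ} ≥ 4·p(X=0)·p(X=1)·α. Equivalently, 1 − p(0,0|0) − p(0,1|1) + M_{X:Λ}/(4 p(X=0) p(X=1)) ≥ 0. -/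
/-- A subconvex combination of two nonnegative reals is at most their maximum. -/
lemma mul_add_mul_le_half_add_abs_sub {u v f g : ℝ} (hu : 0 ≤ u) (hv : 0 ≤ v)
    (hf : 0 ≤ f) (hg : 0 ≤ g) (hfg : f + g ≤ 1) :
    u * f + v * g ≤ (u + v + |u - v|) / 2 := by
  rcases abs_cases (u - v) with ⟨h, h'⟩ | ⟨h, h'⟩ <;> rw [h] <;> nlinarith


/-- Lower bound of Lemma 1 (adapted instrumental inequality): for every
measurement-dependent instrumental model with binary observed variables, if the
observed distribution violates Pearl's inequality by `α > 0`, i.e.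
`p(0,0|0) + p(0,1|1) = 1 + α`, then `M_{X:Λ} ≥ 4 p(X=0) p(X=1) α`. -/
theorem lemma1_lower_bound_measurement_dependence
    {Λ : Type*} [Fintype Λ]
    (q : Fin 2 → Λ → ℝ) (hq0 : ∀ x l, 0 ≤ q x l)
    (hq1 : ∑ x, ∑ l, q x l = 1)
    (px : Fin 2 → ℝ) (hpx : ∀ x, px x = ∑ l, q x l) (hpxpos : ∀ x, 0 < px x)
    (qL : Λ → ℝ) (hqL : ∀ l, qL l = ∑ x, q x l)
    (pA : Fin 2 → Fin 2 → Λ → ℝ)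
    (hA0 : ∀ a x l, 0 ≤ pA a x l) (hA1 : ∀ x l, ∑ a, pA a x l = 1)
    (pB : Fin 2 → Fin 2 → Λ → ℝ)
    (hB0 : ∀ b a l, 0 ≤ pB b a l) (hB1 : ∀ a l, ∑ b, pB b a l = 1)
    (p : Fin 2 → Fin 2 → Fin 2 → ℝ)
    (hp : ∀ a b x, p a b x = (1 / px x) * ∑ l, q x l * pA a x l * pB b a l)
    (M : ℝ) (hM : M = ∑ x, ∑ l, |q x l - px x * qL l|)
    (α : ℝ) (hα : 0 < α)
    (hviol : p 0 0 0 + p 0 1 1 = 1 + α) :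
    4 * px 0 * px 1 * α ≤ M := by
  have hsum : px 0 + px 1 = 1 := by
    rw [hpx, hpx, ← hq1, Fin.sum_univ_two]
  have hMd : M = 2 * ∑ l, |px 1 * q 0 l - px 0 * q 1 l| := by
    have h0 (l : Λ) : q 0 l - px 0 * qL l = px 1 * q 0 l - px 0 * q 1 l := by
      rw [hqL, Fin.sum_univ_two]
      linear_combination -q 0 l * hsum
    have h1 (l : Λ) : q 1 l - px 1 * qL l = -(px 1 * q 0 l - px 0 * q 1 l) := by
      rw [hqL, Fin.sum_univ_two]
      linear_combination -q 1 l * hsum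
    rw [hM, Fin.sum_univ_two]
    simp only [h0, h1, abs_neg]
    ring
  have hpoint (l : Λ) :
      px 1 * (q 0 l * pA 0 0 l * pB 0 0 l) + px 0 * (q 1 l * pA 0 1 l * pB 1 0 l) ≤
        (px 1 * q 0 l + px 0 * q 1 l + |px 1 * q 0 l - px 0 * q 1 l|) / 2 := by
    have hA (x : Fin 2) : pA 0 x l ≤ 1 := by
      have h := hA1 x l
      rw [Fin.sum_univ_two] at h
      linarith [hA0 1 x l]
    have hB := hB1 0 l
    rw [Fin.sum_univ_two] at hB
    have h := mul_add_mul_le_half_add_abs_sub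
      (mul_nonneg (hpxpos 1).le (hq0 0 l)) (mul_nonneg (hpxpos 0).le (hq0 1 l))
      (mul_nonneg (hA0 0 0 l) (hB0 0 0 l)) (mul_nonneg (hA0 0 1 l) (hB0 1 0 l))
      (by linarith [mul_le_of_le_one_left (hB0 0 0 l) (hA 0),
        mul_le_of_le_one_left (hB0 1 0 l) (hA 1)])
    linarith
  have htotal := Finset.sum_le_sum fun l (_ : l ∈ Finset.univ) => hpoint l
  simp only [← Finset.sum_div, Finset.sum_add_distrib, ← Finset.mul_sum, ← hpx] at htotal
  have hp' (a b x : Fin 2) : ∑ l, q x l * pA a x l * pB b a l = px x * p a b x := by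
    rw [hp, ← mul_assoc, mul_one_div_cancel (hpxpos x).ne', one_mul]
  rw [hp', hp'] at htotal
  have hexp : px 1 * (px 0 * p 0 0 0) + px 0 * (px 1 * p 0 1 1) = px 0 * px 1 * (1 + α) := by
    rw [← hviol]
    ring
  linarith
end

section
/- Tightness of Lemma 1: for every p0 ∈ (0,1) and every α ∈ [0,1], there exists a measurement-dependent instrumental model with binary observed variables whose X-marginal is (p(X=0), p(X=1)) = (p0, 1−p0), whose observed distribution satisfies p(0,0|0) + p(0,1|1) = 1 + α (i.e. it violates Pearl's inequality by exactly α), and whose measurement dependence equals M_{X:Λ} = 4·p0·(1−p0)·α. -/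
/-- Tightness of Lemma 1: for every `p0 ∈ (0,1)` and `α ∈ [0,1]`, there exists a
measurement-dependent instrumental model with binary observed variables whose
`X`-marginal is `(p0, 1 − p0)`, whose observed distribution satisfies
`p(0,0|0) + p(0,1|1) = 1 + α`, and whose measurement dependence equals
`M_{X:Λ} = 4 p0 (1 − p0) α`. -/
theorem lemma1_tightness (p0 : ℝ) (hp0 : p0 ∈ Set.Ioo (0 : ℝ) 1)
    (α : ℝ) (hα : α ∈ Set.Icc (0 : ℝ) 1) :
    ∃ (n : ℕ) (q : Fin 2 → Fin n → ℝ)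
      (pA : Fin 2 → Fin 2 → Fin n → ℝ) (pB : Fin 2 → Fin 2 → Fin n → ℝ),
      (∀ x l, 0 ≤ q x l) ∧ (∑ x, ∑ l, q x l = 1) ∧
      (∀ x, 0 < ∑ l, q x l) ∧
      (∑ l, q 0 l = p0) ∧ (∑ l, q 1 l = 1 - p0) ∧
      (∀ a x l, 0 ≤ pA a x l) ∧ (∀ x l, ∑ a, pA a x l = 1) ∧
      (∀ b a l, 0 ≤ pB b a l) ∧ (∀ a l, ∑ b, pB b a l = 1) ∧
      (let px : Fin 2 → ℝ := fun x => ∑ l, q x l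
       let p : Fin 2 → Fin 2 → Fin 2 → ℝ :=
         fun a b x => (1 / px x) * ∑ l, q x l * pA a x l * pB b a l
       p 0 0 0 + p 0 1 1 = 1 + α ∧
         ∑ x, ∑ l, |q x l - px x * ∑ x', q x' l| = 4 * p0 * (1 - p0) * α) := by
  obtain ⟨h0, h1⟩ := hp0
  obtain ⟨hα0, hα1⟩ := hα
  have h1' : 0 < 1 - p0 := sub_pos.2 h1
  have hm : 0 ≤ p0 * (1 - p0) * α := by positivity
  -- The hidden variable is deterministic given `X = 0`, the response `A` is constantly `0`,
  -- and `B` copies the hidden variable.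
  refine ⟨2, ![![p0, 0], ![(1 - p0) * (1 - α), (1 - p0) * α]],
    fun a _ _ => if a = 0 then 1 else 0, fun b _ l => if b = l then 1 else 0,
    ?_, ?_, ?_, ?_, ?_, ?_, ?_, ?_, ?_, ?_, ?_⟩
  · have h2 : 0 ≤ (1 - p0) * (1 - α) := mul_nonneg h1'.le (sub_nonneg.2 hα1)
    have h3 : 0 ≤ (1 - p0) * α := mul_nonneg h1'.le hα0
    simp only [Fin.forall_fin_two]
    exact ⟨⟨h0.le, le_rfl⟩, h2, h3⟩
  · simp only [Fin.sum_univ_two, Matrix.cons_val_zero, Matrix.cons_val_one]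
    ring
  · simp only [Fin.forall_fin_two, Fin.sum_univ_two, Matrix.cons_val_zero, Matrix.cons_val_one]
    constructor <;> linarith
  · simp
  · simp only [Fin.sum_univ_two, Matrix.cons_val_zero, Matrix.cons_val_one]
    ring
  · intro a _ _
    positivity
  · simp
  · intro b _ l
    positivity
  · simp
  · have hs : (1 - p0) * (1 - α) + (1 - p0) * α = 1 - p0 := by ring
    simp [Fin.sum_univ_two, hs]
    field_simp
  · have hs : (1 - p0) * (1 - α) + (1 - p0) * α = 1 - p0 := by ring
    simp only [Fin.sum_univ_two, Matrix.cons_val_zero, Matrix.cons_val_one, hs, add_zero, zero_add]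
    have e1 : p0 - p0 * (p0 + (1 - p0) * (1 - α)) = p0 * (1 - p0) * α := by ring
    have e2 : 0 - p0 * ((1 - p0) * α) = -(p0 * (1 - p0) * α) := by ring
    have e3 : (1 - p0) * (1 - α) - (1 - p0) * (p0 + (1 - p0) * (1 - α)) =
        -(p0 * (1 - p0) * α) := by ring
    have e4 : (1 - p0) * α - (1 - p0) * ((1 - p0) * α) = p0 * (1 - p0) * α := by ring
    rw [e1, e2, e3, e4, abs_neg, abs_of_nonneg hm]
    ring
end

section
/- Lower bound of Lemma 2 (adapted causal bound): for every measurement-dependent instrumental model with binary observed variables, letting C1 = 2·p(0,0|0) + p(1,1|0) + p(0,1|1) + p(1,1|1) − 2, if the Balke–Pearl bound is violated by α, i.e. C1 − ACE_{A→B} = α with α > 0, then M_{X:Λ} ≥ (4·p(X=0)·p(X=1)/(2 − p(X=0)))·α. Equivalently, ACE_{A→B} ≥ C1 − ((2 − p(X=0))/(4 p(X=0) p(X=1)))·M_{X:Λ}. -/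
/-- Pointwise bound on the violation of the Balke–Pearl inequality: `u`, `v` are the weights of a
hidden value given `X = 0` and `X = 1`, `a`, `a'` the probabilities of `A = 0` given `X = 0` and
`X = 1`, and `b`, `c` the probabilities of `B = 0` given `A = 0` and `A = 1`. -/
lemma balkePearl_pointwise_le {s t u v a a' b c : ℝ} (hs : 0 < s) (ht : 0 < t) (hst : s + t = 1)
    (hu : 0 ≤ u) (hv : 0 ≤ v) (ha : 0 ≤ a) (ha1 : a ≤ 1) (ha' : 0 ≤ a') (ha'1 : a' ≤ 1)
    (hb : 0 ≤ b) (hb1 : b ≤ 1) (hc : 0 ≤ c) (hc1 : c ≤ 1) :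
    u * (2 * (a * b) + (1 - a) * (1 - c)) + v * (a' * (1 - b) + (1 - a') * (1 - c))
      - (s * u + t * v) * (b - c) ≤ 2 * u + (1 + t) * ((|u - v| + (v - u)) / 2) := by
  obtain rfl : s = 1 - t := by linarith
  have na : 0 ≤ 1 - a := by linarith
  have na' : 0 ≤ 1 - a' := by linarith
  have nb : 0 ≤ 1 - b := by linarith
  have nc : 0 ≤ 1 - c := by linarith
  have hf : 2 * (a * b) + (1 - a) * (1 - c) - (1 - t) * (b - c) ≤ 2 := by
    have h1 : a * b + (1 - a) * (1 - c) ≤ 1 := by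
      nlinarith [mul_nonneg ha nb, mul_nonneg na hc]
    have h2 : a * b ≤ b := by nlinarith [mul_nonneg na hb]
    nlinarith [mul_nonneg ha nb, mul_nonneg na hc, mul_nonneg hs.le nc, mul_nonneg hs.le hb,
      mul_nonneg ht.le nb, mul_nonneg (mul_nonneg ha hs.le) nc,
      mul_nonneg (mul_nonneg na hs.le) nc, mul_nonneg (mul_nonneg ha ht.le) nb,
      mul_nonneg (mul_nonneg ha hs.le) nb, mul_nonneg (mul_nonneg na hs.le) hb,
      mul_nonneg (mul_nonneg na ht.le) hc]
  have hg : a' * (1 - b) + (1 - a') * (1 - c) - t * (b - c) ≤ 1 + t := by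
    nlinarith [mul_nonneg ha' hb, mul_nonneg na' hc, mul_nonneg ht.le nc, mul_nonneg ht.le hb]
  have hfg : (2 * (a * b) + (1 - a) * (1 - c) - (1 - t) * (b - c))
      + (a' * (1 - b) + (1 - a') * (1 - c) - t * (b - c)) ≤ 2 := by
    nlinarith [mul_nonneg (mul_nonneg ha ha') nc, mul_nonneg (mul_nonneg ha na') nb,
      mul_nonneg (mul_nonneg na ha') hb, mul_nonneg (mul_nonneg na na') hb,
      mul_nonneg (mul_nonneg na na') hc]
  rcases le_total v u with h | h
  · rw [abs_of_nonneg (sub_nonneg.2 h)]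
    nlinarith [mul_le_mul_of_nonneg_left hfg hv,
      mul_le_mul_of_nonneg_left hf (sub_nonneg.2 h)]
  · rw [abs_of_nonpos (sub_nonpos.2 h)]
    nlinarith [mul_le_mul_of_nonneg_left hfg hu,
      mul_le_mul_of_nonneg_left hg (sub_nonneg.2 h)]


/-- Lower bound of Lemma 2 (adapted causal bound): for every measurement-dependent
instrumental model with binary observed variables, with
`C1 = 2 p(0,0|0) + p(1,1|0) + p(0,1|1) + p(1,1|1) − 2`, if the Balke–Pearl bound is
violated by `α > 0`, i.e. `C1 − ACE_{A→B} = α`, then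
`M_{X:Λ} ≥ (4 p(X=0) p(X=1) / (2 − p(X=0))) α`. -/
theorem lemma2_lower_bound_measurement_dependence
    {Λ : Type*} [Fintype Λ]
    (q : Fin 2 → Λ → ℝ) (hq0 : ∀ x l, 0 ≤ q x l)
    (hq1 : ∑ x, ∑ l, q x l = 1)
    (px : Fin 2 → ℝ) (hpx : ∀ x, px x = ∑ l, q x l) (hpxpos : ∀ x, 0 < px x)
    (qL : Λ → ℝ) (hqL : ∀ l, qL l = ∑ x, q x l)
    (pA : Fin 2 → Fin 2 → Λ → ℝ)
    (hA0 : ∀ a x l, 0 ≤ pA a x l) (hA1 : ∀ x l, ∑ a, pA a x l = 1)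
    (pB : Fin 2 → Fin 2 → Λ → ℝ)
    (hB0 : ∀ b a l, 0 ≤ pB b a l) (hB1 : ∀ a l, ∑ b, pB b a l = 1)
    (p : Fin 2 → Fin 2 → Fin 2 → ℝ)
    (hp : ∀ a b x, p a b x = (1 / px x) * ∑ l, q x l * pA a x l * pB b a l)
    (pdo : Fin 2 → Fin 2 → ℝ)
    (hdo : ∀ b a, pdo b a = ∑ l, qL l * pB b a l)
    (ACE : ℝ)
    (hACE : ACE = Finset.univ.sup' Finset.univ_nonempty
      (fun t : Fin 2 × Fin 2 × Fin 2 => |pdo t.2.2 t.1 - pdo t.2.2 t.2.1|))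
    (C1 : ℝ) (hC1 : C1 = 2 * p 0 0 0 + p 1 1 0 + p 0 1 1 + p 1 1 1 - 2)
    (M : ℝ) (hM : M = ∑ x, ∑ l, |q x l - px x * qL l|)
    (α : ℝ) (hα : 0 < α) (hviol : C1 - ACE = α) :
    4 * px 0 * px 1 / (2 - px 0) * α ≤ M := by
  simp only [Fin.sum_univ_two] at hq1 hqL hA1 hB1 hM
  have hs := hpxpos 0
  have ht := hpxpos 1
  have hst : px 0 + px 1 = 1 := by rw [hpx, hpx, hq1]
  set s := px 0 with hs_def
  set t := px 1 with ht_def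
  set u : Λ → ℝ := fun l => q 0 l / s with hu
  set v : Λ → ℝ := fun l => q 1 l / t with hv
  have q0 : ∀ l, q 0 l = s * u l := fun l => by simp only [hu]; field_simp
  have q1 : ∀ l, q 1 l = t * v l := fun l => by simp only [hv]; field_simp
  have su : ∑ l, u l = 1 := by
    simp only [hu]
    rw [← Finset.sum_div, ← hpx 0, ← hs_def, div_self hs.ne']
  have sv : ∑ l, v l = 1 := by
    simp only [hv]
    rw [← Finset.sum_div, ← hpx 1, ← ht_def, div_self ht.ne']
  have u0 : ∀ l, 0 ≤ u l := fun l => div_nonneg (hq0 0 l) hs.le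
  have v0 : ∀ l, 0 ≤ v l := fun l => div_nonneg (hq0 1 l) ht.le
  clear_value u v
  have p0 : ∀ a b, p a b 0 = ∑ l, u l * pA a 0 l * pB b a l := fun a b => by
    rw [hp, Finset.mul_sum]
    exact Finset.sum_congr rfl fun l _ => by rw [q0, ← hs_def]; field_simp
  have p1 : ∀ a b, p a b 1 = ∑ l, v l * pA a 1 l * pB b a l := fun a b => by
    rw [hp, Finset.mul_sum]
    exact Finset.sum_congr rfl fun l _ => by rw [q1, ← ht_def]; field_simp
  have hMd : M = 2 * (s * t) * ∑ l, |u l - v l| := by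
    have e0 : ∀ l, |q 0 l - s * qL l| = s * t * |u l - v l| := fun l => by
      have : q 0 l - s * qL l = s * t * (u l - v l) := by
        rw [hqL, q0, q1]
        linear_combination (-(s * u l)) * hst
      rw [this, abs_mul, abs_of_pos (mul_pos hs ht)]
    have e1 : ∀ l, |q 1 l - t * qL l| = s * t * |u l - v l| := fun l => by
      have : q 1 l - t * qL l = -(s * t * (u l - v l)) := by
        rw [hqL, q0, q1]
        linear_combination (-(t * v l)) * hst
      rw [this, abs_neg, abs_mul, abs_of_pos (mul_pos hs ht)]
    rw [hM]
    simp only [e0, e1, ← Finset.mul_sum]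
    ring
  have hace : pdo 0 0 - pdo 0 1 ≤ ACE := by
    rw [hACE]
    exact (le_abs_self _).trans (Finset.le_sup'
      (fun r : Fin 2 × Fin 2 × Fin 2 => |pdo r.2.2 r.1 - pdo r.2.2 r.2.1|)
      (Finset.mem_univ ((0, 1, 0) : Fin 2 × Fin 2 × Fin 2)))
  have hsum : C1 + 2 - (pdo 0 0 - pdo 0 1) ≤ 2 + (1 + t) * ((∑ l, |u l - v l|) / 2) := by
    have key := Finset.sum_le_sum fun l (_ : l ∈ Finset.univ) =>
      balkePearl_pointwise_le hs ht hst (u0 l) (v0 l) (hA0 0 0 l)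
        (by linarith [hA1 0 l, hA0 1 0 l] : pA 0 0 l ≤ 1) (hA0 0 1 l)
        (by linarith [hA1 1 l, hA0 1 1 l] : pA 0 1 l ≤ 1) (hB0 0 0 l)
        (by linarith [hB1 0 l, hB0 1 0 l] : pB 0 0 l ≤ 1) (hB0 0 1 l)
        (by linarith [hB1 1 l, hB0 1 1 l] : pB 0 1 l ≤ 1)
    refine le_of_eq_of_le ?_ (key.trans_eq ?_)
    · rw [hC1, p0, p0, p1, p1, hdo, hdo]
      rw [Finset.mul_sum, sub_add_cancel]
      simp only [← Finset.sum_add_distrib, ← Finset.sum_sub_distrib]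
      refine Finset.sum_congr rfl fun l _ => ?_
      rw [hqL, q0, q1, eq_sub_of_add_eq' (hA1 0 l), eq_sub_of_add_eq' (hA1 1 l),
        eq_sub_of_add_eq' (hB1 0 l), eq_sub_of_add_eq' (hB1 1 l)]
      ring
    · rw [Finset.sum_add_distrib, ← Finset.mul_sum, ← Finset.mul_sum, ← Finset.sum_div,
        Finset.sum_add_distrib, Finset.sum_sub_distrib, su, sv]
      ring
  have hα_le : 2 * α ≤ (2 - s) * ∑ l, |u l - v l| := by
    have : 2 - s = 1 + t := by linarith
    rw [this]
    linarith
  have h2s : 0 < 2 - s := by linarith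
  rw [hMd, div_mul_eq_mul_div, div_le_iff₀ h2s]
  nlinarith [mul_le_mul_of_nonneg_left hα_le (mul_pos hs ht).le]
end

section
/- Tightness of Lemma 2: for every p0 ∈ (0,1) and every α ∈ [0,1], there exists a measurement-dependent instrumental model with binary observed variables whose X-marginal is (p(X=0), p(X=1)) = (p0, 1−p0) such that, with C1 = 2·p(0,0|0) + p(1,1|0) + p(0,1|1) + p(1,1|1) − 2, the model violates the Balke–Pearl bound by exactly α (i.e. C1 − ACE_{A→B} = α) and its measurement dependence equals M_{X:Λ} = (4·p0·(1−p0)/(2 − p0))·α. -/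
/-- Tightness of Lemma 2: for every `p0 ∈ (0,1)` and `α ∈ [0,1]`, there exists a
measurement-dependent instrumental model with binary observed variables whose
`X`-marginal is `(p0, 1 − p0)` such that, with
`C1 = 2 p(0,0|0) + p(1,1|0) + p(0,1|1) + p(1,1|1) − 2`, the model violates the
Balke–Pearl bound by exactly `α` (i.e. `C1 − ACE_{A→B} = α`) and its measurement
dependence equals `M_{X:Λ} = (4 p0 (1 − p0)/(2 − p0)) α`. -/
theorem lemma2_tightness (p0 : ℝ) (hp0 : p0 ∈ Set.Ioo (0 : ℝ) 1)
    (α : ℝ) (hα : α ∈ Set.Icc (0 : ℝ) 1) :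
    ∃ (n : ℕ) (q : Fin 2 → Fin n → ℝ)
      (pA : Fin 2 → Fin 2 → Fin n → ℝ) (pB : Fin 2 → Fin 2 → Fin n → ℝ),
      (∀ x l, 0 ≤ q x l) ∧ (∑ x, ∑ l, q x l = 1) ∧
      (∀ x, 0 < ∑ l, q x l) ∧
      (∑ l, q 0 l = p0) ∧ (∑ l, q 1 l = 1 - p0) ∧
      (∀ a x l, 0 ≤ pA a x l) ∧ (∀ x l, ∑ a, pA a x l = 1) ∧
      (∀ b a l, 0 ≤ pB b a l) ∧ (∀ a l, ∑ b, pB b a l = 1) ∧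
      (let px : Fin 2 → ℝ := fun x => ∑ l, q x l
       let qL : Fin n → ℝ := fun l => ∑ x, q x l
       let p : Fin 2 → Fin 2 → Fin 2 → ℝ :=
         fun a b x => (1 / px x) * ∑ l, q x l * pA a x l * pB b a l
       let pdo : Fin 2 → Fin 2 → ℝ := fun b a => ∑ l, qL l * pB b a l
       let ACE : ℝ := Finset.univ.sup' Finset.univ_nonempty
         (fun t : Fin 2 × Fin 2 × Fin 2 => |pdo t.2.2 t.1 - pdo t.2.2 t.2.1|)
       let C1 : ℝ := 2 * p 0 0 0 + p 1 1 0 + p 0 1 1 + p 1 1 1 - 2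
       C1 - ACE = α ∧
         ∑ x, ∑ l, |q x l - px x * qL l| = 4 * p0 * (1 - p0) / (2 - p0) * α) := by
  obtain ⟨h0, h1⟩ := hp0
  obtain ⟨hα0, hα1⟩ := hα
  have h2 : 0 < 2 - p0 := by linarith
  obtain ⟨t, rfl⟩ : ∃ t, α = (2 - p0) * t := ⟨α / (2 - p0), by field_simp⟩
  have ht0 : 0 ≤ t := nonneg_of_mul_nonneg_right hα0 h2
  have ht1 : t ≤ 1 := by nlinarith
  have h3 : 0 < 1 - p0 := by linarith
  have h4 : 0 ≤ 1 - t := by linarith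
  have hM : 4 * p0 * (1 - p0) / (2 - p0) * ((2 - p0) * t) = 4 * p0 * (1 - p0) * t := by
    field_simp
  have hs0 : p0 * (1 - t) + p0 * t = p0 := by ring
  have hs1 : (1 - p0) * (1 - t) + (1 - p0) * t = 1 - p0 := by ring
  -- Latent values: `b = a` for `0`, `b = 0` for `1`, and `b = 1 - a` for `2`.
  refine ⟨3, ![![p0 * (1 - t), p0 * t, 0], ![(1 - p0) * (1 - t), 0, (1 - p0) * t]],
    ![![![1, 1, 1], ![0, 0, 1]], ![![0, 0, 0], ![1, 1, 0]]],
    ![![![1, 1, 0], ![0, 1, 1]], ![![0, 0, 1], ![1, 0, 0]]], ?_, ?_, ?_, ?_, ?_, ?_, ?_, ?_, ?_, ?_⟩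
  · intro x l
    fin_cases x <;> fin_cases l <;> simp <;> positivity
  · simp [Fin.sum_univ_succ, hs0, hs1]
  · intro x
    fin_cases x <;> simp [Fin.sum_univ_succ, hs0, hs1, h0, h1]
  · simp [Fin.sum_univ_succ, hs0]
  · simp [Fin.sum_univ_succ, hs1]
  · intro a x l
    fin_cases a <;> fin_cases x <;> fin_cases l <;> simp
  · intro x l
    fin_cases x <;> fin_cases l <;> simp
  · intro b a l
    fin_cases b <;> fin_cases a <;> fin_cases l <;> simp
  · intro a l
    fin_cases a <;> fin_cases l <;> simp
  · intro px qL p pdo ACE C1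
    have hpx0 : px 0 = p0 := by simp [px, Fin.sum_univ_succ, hs0]
    have hpx1 : px 1 = 1 - p0 := by simp [px, Fin.sum_univ_succ, hs1]
    have hqL0 : qL 0 = 1 - t := by simp [qL]; ring
    have hqL1 : qL 1 = p0 * t := by simp [qL]
    have hqL2 : qL 2 = (1 - p0) * t := by simp [qL]
    have hC1 : C1 = 1 := by
      simp only [C1, p, hpx0, hpx1]
      simp [Fin.sum_univ_succ]
      field_simp
      ring
    have hd00 : pdo 0 0 = 1 - (1 - p0) * t := by
      simp [pdo, Fin.sum_univ_three, hqL0, hqL1, hqL2]; ring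
    have hd01 : pdo 0 1 = t := by
      simp [pdo, Fin.sum_univ_three, hqL0, hqL1, hqL2]; ring
    have hd10 : pdo 1 0 = (1 - p0) * t := by
      simp [pdo, Fin.sum_univ_three, hqL0, hqL1, hqL2]
    have hd11 : pdo 1 1 = 1 - t := by
      simp [pdo, Fin.sum_univ_three, hqL0, hqL1, hqL2]
    have hACE : ACE = 1 - (2 - p0) * t := by
      apply le_antisymm
      · refine Finset.sup'_le _ _ ?_
        rintro ⟨a, a', b⟩ -
        fin_cases a <;> fin_cases a' <;> fin_cases b <;>
          simp only [Fin.zero_eta, Fin.mk_one, hd00, hd01, hd10, hd11, abs_le] <;>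
          constructor <;> linarith
      · refine le_trans ?_ (Finset.le_sup' _ (Finset.mem_univ ((1, 0, 1) : Fin 2 × Fin 2 × Fin 2)))
        simp only [hd10, hd11]
        refine le_trans (le_of_eq ?_) (le_abs_self _)
        ring
    refine ⟨by rw [hC1, hACE]; ring, ?_⟩
    rw [hM]
    have hpt : 0 ≤ p0 * (1 - p0) * t := by positivity
    simp only [Fin.sum_univ_two, Fin.sum_univ_three, hpx0, hpx1, hqL0, hqL1, hqL2]
    simp only [Matrix.cons_val]
    rw [show p0 * (1 - t) - p0 * (1 - t) = 0 by ring,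
      show p0 * t - p0 * (p0 * t) = p0 * (1 - p0) * t by ring,
      show 0 - p0 * ((1 - p0) * t) = -(p0 * (1 - p0) * t) by ring,
      show (1 - p0) * (1 - t) - (1 - p0) * (1 - t) = 0 by ring,
      show 0 - (1 - p0) * (p0 * t) = -(p0 * (1 - p0) * t) by ring,
      show (1 - p0) * t - (1 - p0) * ((1 - p0) * t) = p0 * (1 - p0) * t by ring,
      abs_neg, abs_zero, abs_of_nonneg hpt]
    ring
end

section
/- Lower bound of Lemma 3 (informational cost): for every measurement-dependent instrumental model with binary observed variables in which X is uniformly distributed (p(X=0) = p(X=1) = 1/2), if K_inst := 1 − p(0,0|0) − p(0,1|1) < 0, then the mutual information between X and Λ satisfies I(X;Λ) ≥ 1 − h((1 − K_inst)/2), where h(t) = −t·log₂ t − (1−t)·log₂(1−t) is the binary entropy function. -/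
/-- A term of the mutual information with a uniform first variable, split into its bias part. -/
theorem ite_mul_logb_div_half_mul {a m : ℝ} (ha : 0 ≤ a) (ham : a ≤ m) :
    (if 0 < a then a * Real.logb 2 (a / (1 / 2 * m)) else 0)
      = a + a * Real.log (a / m) / Real.log 2 := by
  rcases ha.eq_or_lt with rfl | ha
  · simp
  have hm : 0 < m := ha.trans_le ham
  have hl : Real.log 2 ≠ 0 := (Real.log_pos one_lt_two).ne'
  rw [if_pos ha, show a / (1 / 2 * m) = 2 * (a / m) by field_simp, Real.logb,
    Real.log_mul two_ne_zero (div_pos ha hm).ne']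
  field_simp

theorem mul_log_div_add_mul_log_div_eq_neg_binEntropy {a b : ℝ} (ha : 0 ≤ a) (hb : 0 ≤ b) :
    a * Real.log (a / (a + b)) + b * Real.log (b / (a + b))
      = -((a + b) * Real.binEntropy (max a b / (a + b))) := by
  rcases (add_nonneg ha hb).eq_or_lt with hm | hm
  · obtain rfl : a = 0 := by linarith
    obtain rfl : b = 0 := by linarith
    simp
  have hba : 1 - a / (a + b) = b / (a + b) := by field_simp; ring
  have hab : 1 - b / (a + b) = a / (a + b) := by field_simp; ring
  have hmax : Real.binEntropy (max a b / (a + b)) = Real.binEntropy (a / (a + b)) := by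
    rcases max_choice a b with h | h <;> rw [h]
    rw [← Real.binEntropy_one_sub, hab]
  rw [hmax, Real.binEntropy, hba, Real.log_inv, Real.log_inv]
  field_simp
  ring

/-- The contribution of one value of the hidden variable to the mutual information. -/
theorem ite_mul_logb_add_ite_mul_logb {a b : ℝ} (ha : 0 ≤ a) (hb : 0 ≤ b) :
    (if 0 < a then a * Real.logb 2 (a / (1 / 2 * (a + b))) else 0)
      + (if 0 < b then b * Real.logb 2 (b / (1 / 2 * (a + b))) else 0)
      = (a + b) - (a + b) * Real.binEntropy (max a b / (a + b)) / Real.log 2 := by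
  rw [ite_mul_logb_div_half_mul ha (by linarith), ite_mul_logb_div_half_mul hb (by linarith)]
  have h := mul_log_div_add_mul_log_div_eq_neg_binEntropy ha hb
  have hl : Real.log 2 ≠ 0 := (Real.log_pos one_lt_two).ne'
  field_simp
  linarith

/-- The conditional entropy of a bit is at most the binary entropy of the optimal guessing
probability. -/
theorem sum_mul_binEntropy_max_div_le {ι : Type*} [Fintype ι] {a b : ι → ℝ}
    (ha : ∀ i, 0 ≤ a i) (hb : ∀ i, 0 ≤ b i) (hab : ∑ i, (a i + b i) = 1) :
    ∑ i, (a i + b i) * Real.binEntropy (max (a i) (b i) / (a i + b i))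
      ≤ Real.binEntropy (∑ i, max (a i) (b i)) := by
  have hm i : 0 ≤ a i + b i := add_nonneg (ha i) (hb i)
  have hle i : max (a i) (b i) ≤ a i + b i :=
    max_le (by linarith [hb i]) (by linarith [ha i])
  have hJ := Real.strictConcave_binEntropy.concaveOn.le_map_sum (t := Finset.univ)
    (w := fun i => a i + b i) (p := fun i => max (a i) (b i) / (a i + b i))
    (fun i _ => hm i) hab
    (fun i _ => ⟨div_nonneg (le_max_of_le_left (ha i)) (hm i), div_le_one_of_le₀ (hle i) (hm i)⟩)
  simp only [smul_eq_mul] at hJ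
  refine hJ.trans_eq (congrArg _ (Finset.sum_congr rfl fun i _ => ?_))
  rcases (hm i).eq_or_lt with h0 | h0
  · have h1 := hle i
    have h2 : 0 ≤ max (a i) (b i) := le_max_of_le_left (ha i)
    rw [← h0] at h1 ⊢
    rw [zero_mul]
    exact le_antisymm h2 h1
  · field_simp

theorem mul_mul_add_mul_mul_le_max {a b c d r s : ℝ} (ha : 0 ≤ a) (hb : 0 ≤ b) (hc1 : c ≤ 1)
    (hd1 : d ≤ 1) (hr : 0 ≤ r) (hs : 0 ≤ s) (hrs : r + s = 1) :
    a * c * r + b * d * s ≤ max a b := by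
  have h1 : a * c * r ≤ max a b * r :=
    mul_le_mul_of_nonneg_right ((mul_le_of_le_one_right ha hc1).trans (le_max_left a b)) hr
  have h2 : b * d * s ≤ max a b * s :=
    mul_le_mul_of_nonneg_right ((mul_le_of_le_one_right hb hd1).trans (le_max_right a b)) hs
  calc _ ≤ max a b * r + max a b * s := add_le_add h1 h2
    _ = max a b := by rw [← mul_add, hrs, mul_one]

/-- Lower bound of Lemma 3 (informational cost): for every measurement-dependent
instrumental model with binary observed variables in which `X` is uniform, if
`K_inst = 1 − p(0,0|0) − p(0,1|1) < 0`, then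
`I(X;Λ) ≥ 1 − h((1 − K_inst)/2)` with `h` the binary entropy (base 2). -/
theorem lemma3_informational_cost_lower_bound
    {Λ : Type*} [Fintype Λ]
    (q : Fin 2 → Λ → ℝ) (hq0 : ∀ x l, 0 ≤ q x l)
    (hq1 : ∑ x, ∑ l, q x l = 1)
    (px : Fin 2 → ℝ) (hpx : ∀ x, px x = ∑ l, q x l) (hpxpos : ∀ x, 0 < px x)
    (huniform : px 0 = 1 / 2 ∧ px 1 = 1 / 2)
    (qL : Λ → ℝ) (hqL : ∀ l, qL l = ∑ x, q x l)
    (pA : Fin 2 → Fin 2 → Λ → ℝ)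
    (hA0 : ∀ a x l, 0 ≤ pA a x l) (hA1 : ∀ x l, ∑ a, pA a x l = 1)
    (pB : Fin 2 → Fin 2 → Λ → ℝ)
    (hB0 : ∀ b a l, 0 ≤ pB b a l) (hB1 : ∀ a l, ∑ b, pB b a l = 1)
    (p : Fin 2 → Fin 2 → Fin 2 → ℝ)
    (hp : ∀ a b x, p a b x = (1 / px x) * ∑ l, q x l * pA a x l * pB b a l)
    (I : ℝ)
    (hI : I = ∑ x, ∑ l, if 0 < q x l then
      q x l * Real.logb 2 (q x l / (px x * qL l)) else 0)
    (h : ℝ → ℝ)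
    (hh : ∀ t, h t = -(t * Real.logb 2 t) - (1 - t) * Real.logb 2 (1 - t))
    (Kinst : ℝ) (hK : Kinst = 1 - p 0 0 0 - p 0 1 1) (hneg : Kinst < 0) :
    1 - h ((1 - Kinst) / 2) ≤ I := by
  obtain ⟨hp0, hp1⟩ := huniform
  simp only [Fin.sum_univ_two] at hq1 hqL hA1 hB1 hI
  have hm : ∑ l, (q 0 l + q 1 l) = 1 := by rw [Finset.sum_add_distrib, hq1]
  have hs : (1 - Kinst) / 2
      = ∑ l, (q 0 l * pA 0 0 l * pB 0 0 l + q 1 l * pA 0 1 l * pB 1 0 l) := by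
    rw [hK, hp, hp, hp0, hp1, Finset.sum_add_distrib]
    ring
  have hsM : (1 - Kinst) / 2 ≤ ∑ l, max (q 0 l) (q 1 l) := by
    rw [hs]
    refine Finset.sum_le_sum fun l _ => ?_
    exact mul_mul_add_mul_mul_le_max (hq0 0 l) (hq0 1 l) (by linarith [hA1 0 l, hA0 1 0 l])
      (by linarith [hA1 1 l, hA0 1 1 l]) (hB0 0 0 l) (hB0 1 0 l) (hB1 0 l)
  have hM1 : ∑ l, max (q 0 l) (q 1 l) ≤ 1 := by
    rw [← hm]
    exact Finset.sum_le_sum fun l _ =>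
      max_le (by linarith [hq0 1 l]) (by linarith [hq0 0 l])
  have hanti : Real.binEntropy (∑ l, max (q 0 l) (q 1 l))
      ≤ Real.binEntropy ((1 - Kinst) / 2) :=
    Real.binEntropy_strictAntiOn.antitoneOn
      ⟨by linarith, by linarith⟩ ⟨by linarith, by linarith⟩ hsM
  have hI' : I = 1 - (∑ l, (q 0 l + q 1 l) *
      Real.binEntropy (max (q 0 l) (q 1 l) / (q 0 l + q 1 l))) / Real.log 2 := by
    rw [hI, hp0, hp1, ← Finset.sum_add_distrib, Finset.sum_div]
    refine .trans (Finset.sum_congr rfl fun l _ => ?_)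
      ((Finset.sum_sub_distrib (fun l => q 0 l + q 1 l) _).trans (congrArg (· - _) hm))
    rw [hqL]
    exact ite_mul_logb_add_ite_mul_logb (hq0 0 l) (hq0 1 l)
  have hh' : h ((1 - Kinst) / 2) = Real.binEntropy ((1 - Kinst) / 2) / Real.log 2 := by
    rw [hh, Real.binEntropy, Real.log_inv, Real.log_inv, Real.logb, Real.logb]
    ring
  rw [hh', hI']
  exact sub_le_sub_left (div_le_div_of_nonneg_right
    ((sum_mul_binEntropy_max_div_le (hq0 0) (hq0 1) hm).trans hanti)
    (Real.log_pos one_lt_two).le) 1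
end

section
/- Tightness of Lemma 3: for every v ∈ (0,1] there exists a measurement-dependent instrumental model with binary observed variables in which X is uniformly distributed (p(X=0) = p(X=1) = 1/2), whose observed distribution satisfies 1 − p(0,0|0) − p(0,1|1) = −v, and whose mutual information equals I(X;Λ) = 1 − h((1 + v)/2), where h(t) = −t·log₂ t − (1−t)·log₂(1−t) is the binary entropy function. -/
/-- A term of the mutual information of the uniform binary symmetric joint distribution. -/
theorem ite_half_mul_logb_eq {t : ℝ} (ht : 0 ≤ t) :
    (if 0 < t / 2 then t / 2 * Real.logb 2 (t / 2 / (1 / 2 * (1 / 2))) else 0)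
      = t / 2 + t * Real.logb 2 t / 2 := by
  rcases ht.eq_or_lt with rfl | ht
  · simp
  · rw [if_pos (by positivity), show t / 2 / (1 / 2 * (1 / 2)) = 2 * t by ring,
      Real.logb_mul two_ne_zero ht.ne', Real.logb_self_eq_one one_lt_two]
    ring

/-- Tightness of Lemma 3: for every `v ∈ (0,1]` there exists a measurement-dependent
instrumental model with binary observed variables in which `X` is uniform, whose
observed distribution satisfies `1 − p(0,0|0) − p(0,1|1) = −v`, and whose mutual
information equals `I(X;Λ) = 1 − h((1+v)/2)` with `h` the binary entropy (base 2). -/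
theorem lemma3_tightness (v : ℝ) (hv : v ∈ Set.Ioc (0 : ℝ) 1) :
    ∃ (n : ℕ) (q : Fin 2 → Fin n → ℝ)
      (pA : Fin 2 → Fin 2 → Fin n → ℝ) (pB : Fin 2 → Fin 2 → Fin n → ℝ),
      (∀ x l, 0 ≤ q x l) ∧ (∑ x, ∑ l, q x l = 1) ∧
      (∀ x, 0 < ∑ l, q x l) ∧
      (∑ l, q 0 l = 1 / 2) ∧ (∑ l, q 1 l = 1 / 2) ∧
      (∀ a x l, 0 ≤ pA a x l) ∧ (∀ x l, ∑ a, pA a x l = 1) ∧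
      (∀ b a l, 0 ≤ pB b a l) ∧ (∀ a l, ∑ b, pB b a l = 1) ∧
      (let px : Fin 2 → ℝ := fun x => ∑ l, q x l
       let qL : Fin n → ℝ := fun l => ∑ x, q x l
       let p : Fin 2 → Fin 2 → Fin 2 → ℝ :=
         fun a b x => (1 / px x) * ∑ l, q x l * pA a x l * pB b a l
       let h : ℝ → ℝ := fun t => -(t * Real.logb 2 t) - (1 - t) * Real.logb 2 (1 - t)
       1 - p 0 0 0 - p 0 1 1 = -v ∧
         (∑ x, ∑ l, if 0 < q x l then
             q x l * Real.logb 2 (q x l / (px x * qL l)) else 0)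
           = 1 - h ((1 + v) / 2)) := by
  obtain ⟨hv0, hv1⟩ := hv
  obtain ⟨t, ht⟩ : ∃ t, t = (1 + v) / 2 := ⟨_, rfl⟩
  have ht0 : 0 ≤ t := by linarith
  have ht1 : 0 ≤ 1 - t := by linarith
  refine ⟨2, fun x l => if x = l then t / 2 else (1 - t) / 2, fun a _ _ => if a = 0 then 1 else 0,
    fun b _ l => if b = l then 1 else 0, ?_, ?_, ?_, ?_, ?_, ?_, ?_, ?_, ?_, ?_⟩
  · intro x l
    dsimp only
    split_ifs <;> positivity
  · simp only [Fin.sum_univ_two, Fin.isValue, zero_ne_one, one_ne_zero, if_true, if_false]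
    ring
  · intro x
    fin_cases x <;> simp [Fin.sum_univ_two] <;> linarith
  · simp only [Fin.sum_univ_two, Fin.isValue, zero_ne_one, if_true, if_false]
    ring
  · simp only [Fin.sum_univ_two, Fin.isValue, one_ne_zero, if_true, if_false]
    ring
  · intro a x l
    dsimp only
    split_ifs <;> norm_num
  · simp
  · intro b a l
    dsimp only
    split_ifs <;> norm_num
  · simp
  · have h0 : t / 2 + (1 - t) / 2 = 1 / 2 := by ring
    have h1 : (1 - t) / 2 + t / 2 = 1 / 2 := by ring
    simp only [Fin.sum_univ_two, Fin.isValue, zero_ne_one, one_ne_zero, if_true, if_false, h0, h1,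
      ← ht, ite_half_mul_logb_eq ht0, ite_half_mul_logb_eq ht1]
    constructor
    · linarith
    · ring
end

section
/- Intermediate estimate in the proof of Lemma 3: for every deterministic measurement-dependent instrumental model with binary observed variables in which X is uniformly distributed (p(X=0) = p(X=1) = 1/2), one has (p(0,0|0) + p(0,1|1))/2 ≤ ∑_{λ : g_λ(0)=0} q(0,λ) + ∑_{λ : g_λ(0)=1} q(1,λ); that is, (p(0,0|0) + p(0,1|1))/2 is at most the probability that X equals g_Λ(0). -/
/-- Intermediate estimate in the proof of Lemma 3: for every deterministic
measurement-dependent instrumental model with binary observed variables in which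
`X` is uniform, `(p(0,0|0) + p(0,1|1))/2` is at most the probability that `X`
equals `g_Λ(0)`, i.e.
`(p(0,0|0) + p(0,1|1))/2 ≤ ∑_{λ : g_λ(0)=0} q(0,λ) + ∑_{λ : g_λ(0)=1} q(1,λ)`. -/
theorem lemma3_intermediate_estimate
    {Λ : Type*} [Fintype Λ]
    (q : Fin 2 → Λ → ℝ) (hq0 : ∀ x l, 0 ≤ q x l)
    (hq1 : ∑ x, ∑ l, q x l = 1)
    (px : Fin 2 → ℝ) (hpx : ∀ x, px x = ∑ l, q x l) (hpxpos : ∀ x, 0 < px x)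
    (huniform : px 0 = 1 / 2 ∧ px 1 = 1 / 2)
    (f : Λ → Fin 2 → Fin 2) (g : Λ → Fin 2 → Fin 2)
    (p : Fin 2 → Fin 2 → Fin 2 → ℝ)
    (hp : ∀ a b x, p a b x =
      (1 / px x) * ∑ l, if f l x = a ∧ g l a = b then q x l else 0) :
    (p 0 0 0 + p 0 1 1) / 2 ≤
      (∑ l, if g l 0 = 0 then q 0 l else 0) + ∑ l, if g l 0 = 1 then q 1 l else 0 := by
  have key : ∀ x b : Fin 2, (∑ l, if f l x = 0 ∧ g l 0 = b then q x l else 0) ≤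
      ∑ l, if g l 0 = b then q x l else 0 := by
    intro x b
    refine Finset.sum_le_sum fun l _ => ?_
    have := hq0 x l
    split_ifs <;> simp_all
  have h0 := key 0 0
  have h1 := key 1 1
  rw [hp, hp, huniform.1, huniform.2]
  linarith
end

section
/- New causal bound C2 for a trinary instrument: for every classical instrumental model with binary A, B and instrument X taking values in {0,1,2}, the average causal effect satisfies ACE_{A→B} ≥ p(0,0|0) + p(0,0|2) + p(1,0|0) + p(1,1|1) + p(1,1|2) − 2. -/
/-- The pointwise inequality behind `C2`, for response probabilities `u = p(0|do 0)`,
`v = p(0|do 1)` and `x i = p(A = 0 | X = i)` at a fixed value of the hidden variable. -/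
lemma response_combination_le_sub {u v x₀ x₁ x₂ : ℝ}
    (hu0 : 0 ≤ u) (hu1 : 0 ≤ 1 - u) (hv0 : 0 ≤ v) (hv1 : 0 ≤ 1 - v)
    (h₀ : 0 ≤ x₀) (h₀' : 0 ≤ 1 - x₀) (h₁ : 0 ≤ x₁) (h₂ : 0 ≤ x₂) (h₂' : 0 ≤ 1 - x₂) :
    x₀ * u + x₂ * u + (1 - x₀) * v + (1 - x₁) * (1 - v) + (1 - x₂) * (1 - v) - 2 ≤ u - v := by
  have h : 0 ≤ u * v * (1 - x₂) + u * (1 - v) * ((1 - x₀) + x₁) + (1 - u) * v * x₀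
      + (1 - u) * (1 - v) * (x₁ + x₂) := by positivity
  linarith

/-- New causal bound `C2` for a trinary instrument: for every classical instrumental
model with binary `A`, `B` and instrument `X ∈ {0,1,2}`, the average causal effect
satisfies `ACE_{A→B} ≥ p(0,0|0) + p(0,0|2) + p(1,0|0) + p(1,1|1) + p(1,1|2) − 2`. -/
theorem causal_bound_C2_trinary_instrument
    {Λ : Type*} [Fintype Λ]
    (μ : Λ → ℝ) (hμ0 : ∀ l, 0 ≤ μ l) (hμ1 : ∑ l, μ l = 1)
    (pA : Fin 2 → Fin 3 → Λ → ℝ)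
    (hA0 : ∀ a x l, 0 ≤ pA a x l) (hA1 : ∀ x l, ∑ a, pA a x l = 1)
    (pB : Fin 2 → Fin 2 → Λ → ℝ)
    (hB0 : ∀ b a l, 0 ≤ pB b a l) (hB1 : ∀ a l, ∑ b, pB b a l = 1)
    (p : Fin 2 → Fin 2 → Fin 3 → ℝ)
    (hp : ∀ a b x, p a b x = ∑ l, μ l * pA a x l * pB b a l)
    (pdo : Fin 2 → Fin 2 → ℝ)
    (hdo : ∀ b a, pdo b a = ∑ l, μ l * pB b a l)
    (ACE : ℝ)
    (hACE : ACE = Finset.univ.sup' Finset.univ_nonempty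
      (fun t : Fin 2 × Fin 2 × Fin 2 => |pdo t.2.2 t.1 - pdo t.2.2 t.2.1|)) :
    p 0 0 0 + p 0 0 2 + p 1 0 0 + p 1 1 1 + p 1 1 2 - 2 ≤ ACE := by
  have hle : pdo 0 0 - pdo 0 1 ≤ ACE := by
    rw [hACE]
    exact (le_abs_self _).trans (Finset.le_sup'
      (fun t : Fin 2 × Fin 2 × Fin 2 => |pdo t.2.2 t.1 - pdo t.2.2 t.2.1|)
      (Finset.mem_univ (0, 1, 0)))
  refine le_trans ?_ hle
  have h2 : (2 : ℝ) = ∑ l, μ l * 2 := by rw [← Finset.sum_mul, hμ1, one_mul]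
  rw [h2]
  simp only [hp, hdo, ← Finset.sum_add_distrib, ← Finset.sum_sub_distrib]
  refine Finset.sum_le_sum fun l _ => ?_
  have eA (x) : pA 1 x l = 1 - pA 0 x l := by
    linarith [(Fin.sum_univ_two fun a => pA a x l).symm.trans (hA1 x l)]
  have eB (a) : pB 1 a l = 1 - pB 0 a l := by
    linarith [(Fin.sum_univ_two fun b => pB b a l).symm.trans (hB1 a l)]
  have key := mul_le_mul_of_nonneg_left (response_combination_le_sub
    (hB0 0 0 l) (eB 0 ▸ hB0 1 0 l) (hB0 0 1 l) (eB 1 ▸ hB0 1 1 l)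
    (hA0 0 0 l) (eA 0 ▸ hA0 1 0 l) (hA0 0 1 l) (hA0 0 2 l) (eA 2 ▸ hA0 1 2 l)) (hμ0 l)
  rw [eA, eA, eA, eB]
  linarith
end

section
/- New causal bound C3 for a trinary instrument: for every classical instrumental model with binary A, B and instrument X taking values in {0,1,2}, the average causal effect satisfies ACE_{A→B} ≥ p(0,0|0) + p(0,0|1) − p(0,1|1) + p(0,1|2) + p(1,0|0) − p(1,0|1) + p(1,1|1) + p(1,1|2) − 2. -/
/-- Pointwise form of the bound: `x i` is the probability of outcome `A = 0` given instrument
value `i`, and `u`, `v` are the probabilities of `B = 0` given `A = 0`, `A = 1`. -/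
lemma instrumental_response_bound_s12 {x₀ x₁ x₂ u v : ℝ}
    (hx₀ : x₀ ∈ Set.Icc 0 1) (hx₁ : x₁ ∈ Set.Icc 0 1) (hx₂ : x₂ ∈ Set.Icc 0 1)
    (hu : u ∈ Set.Icc 0 1) (hv : v ∈ Set.Icc 0 1) :
    x₀ * u + x₁ * u - x₁ * (1 - u) + x₂ * (1 - u) + (1 - x₀) * v - (1 - x₁) * v
      + (1 - x₁) * (1 - v) + (1 - x₂) * (1 - v) - 2 ≤ u - v := by
  obtain ⟨a₀, b₀⟩ := hx₀
  obtain ⟨a₁, b₁⟩ := hx₁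
  obtain ⟨a₂, b₂⟩ := hx₂
  obtain ⟨u₀, u₁⟩ := hu
  obtain ⟨v₀, v₁⟩ := hv
  have h₁ : 0 ≤ x₁ * ((1 - u) * (1 - (x₂ - x₀)) + (1 - v) * (1 + (x₂ - x₀))) :=
    mul_nonneg a₁ (add_nonneg (mul_nonneg (by linarith) (by linarith))
      (mul_nonneg (by linarith) (by linarith)))
  have h₂ : 0 ≤ (1 - x₁) * (u * (1 + (x₂ - x₀)) + v * (1 - (x₂ - x₀))) :=
    mul_nonneg (by linarith) (add_nonneg (mul_nonneg u₀ (by linarith))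
      (mul_nonneg v₀ (by linarith)))
  linarith

/-- New causal bound `C3` for a trinary instrument: for every classical instrumental
model with binary `A`, `B` and instrument `X ∈ {0,1,2}`, the average causal effect
satisfies `ACE_{A→B} ≥ p(0,0|0) + p(0,0|1) − p(0,1|1) + p(0,1|2) + p(1,0|0) − p(1,0|1)
+ p(1,1|1) + p(1,1|2) − 2`. -/
theorem causal_bound_C3_trinary_instrument
    {Λ : Type*} [Fintype Λ]
    (μ : Λ → ℝ) (hμ0 : ∀ l, 0 ≤ μ l) (hμ1 : ∑ l, μ l = 1)
    (pA : Fin 2 → Fin 3 → Λ → ℝ)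
    (hA0 : ∀ a x l, 0 ≤ pA a x l) (hA1 : ∀ x l, ∑ a, pA a x l = 1)
    (pB : Fin 2 → Fin 2 → Λ → ℝ)
    (hB0 : ∀ b a l, 0 ≤ pB b a l) (hB1 : ∀ a l, ∑ b, pB b a l = 1)
    (p : Fin 2 → Fin 2 → Fin 3 → ℝ)
    (hp : ∀ a b x, p a b x = ∑ l, μ l * pA a x l * pB b a l)
    (pdo : Fin 2 → Fin 2 → ℝ)
    (hdo : ∀ b a, pdo b a = ∑ l, μ l * pB b a l)
    (ACE : ℝ)
    (hACE : ACE = Finset.univ.sup' Finset.univ_nonempty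
      (fun t : Fin 2 × Fin 2 × Fin 2 => |pdo t.2.2 t.1 - pdo t.2.2 t.2.1|)) :
    p 0 0 0 + p 0 0 1 - p 0 1 1 + p 0 1 2 + p 1 0 0 - p 1 0 1 + p 1 1 1 + p 1 1 2 - 2 ≤ ACE := by
  have hle : pdo 0 0 - pdo 0 1 ≤ ACE := by
    rw [hACE]
    exact (le_abs_self _).trans (Finset.le_sup'
      (fun t : Fin 2 × Fin 2 × Fin 2 => |pdo t.2.2 t.1 - pdo t.2.2 t.2.1|)
      (Finset.mem_univ ((0, 1, 0) : Fin 2 × Fin 2 × Fin 2)))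
  refine le_trans ?_ hle
  have htwo : (2 : ℝ) = ∑ l, μ l * 2 := by rw [← Finset.sum_mul, hμ1, one_mul]
  rw [htwo]
  simp only [hp, hdo, ← Finset.sum_add_distrib, ← Finset.sum_sub_distrib]
  refine Finset.sum_le_sum fun l _ => ?_
  simp only [Fin.sum_univ_two] at hA1 hB1
  have hA (x) : pA 1 x l = 1 - pA 0 x l := by linarith [hA1 x l]
  have hB (a) : pB 1 a l = 1 - pB 0 a l := by linarith [hB1 a l]
  have mA (x) : pA 0 x l ∈ Set.Icc 0 1 := ⟨hA0 0 x l, by linarith [hA0 1 x l, hA x]⟩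
  have mB (a) : pB 0 a l ∈ Set.Icc 0 1 := ⟨hB0 0 a l, by linarith [hB0 1 a l, hB a]⟩
  have key := mul_le_mul_of_nonneg_left
    (instrumental_response_bound_s12 (mA 0) (mA 1) (mA 2) (mB 0) (mB 1)) (hμ0 l)
  simp only [hA, hB]
  linarith
end

section
/- Maximization of the dependence coefficient: for every p ∈ [0,1], 4·p·(1−p)/(2−p) ≤ 12 − 8·√2, with equality if and only if p = 2 − √2. Consequently, the maximum over p ∈ [0,1] of (4·p·(1−p)/(2−p))·(3 − 2√2) equals 68 − 48·√2, attained at p = 2 − √2. -/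
/-- The gap between `12 - 8√2` and the dependence coefficient is a perfect square over `2 - p`. -/
theorem sub_dependence_coefficient_eq {p : ℝ} (hp : p ≠ 2) :
    12 - 8 * Real.sqrt 2 - 4 * p * (1 - p) / (2 - p) =
      4 * (p - (2 - Real.sqrt 2)) ^ 2 / (2 - p) := by
  have hs : Real.sqrt 2 ^ 2 = 2 := Real.sq_sqrt zero_le_two
  have h : 2 - p ≠ 0 := sub_ne_zero.2 hp.symm
  rw [eq_div_iff h, sub_mul, div_mul_cancel₀ _ h]
  linear_combination -4 * hs

theorem dependence_coefficient_le {p : ℝ} (hp : p < 2) :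
    4 * p * (1 - p) / (2 - p) ≤ 12 - 8 * Real.sqrt 2 := by
  have h : 0 < 2 - p := sub_pos.2 hp
  rw [← sub_nonneg, sub_dependence_coefficient_eq hp.ne]
  positivity

theorem dependence_coefficient_eq_iff {p : ℝ} (hp : p ≠ 2) :
    4 * p * (1 - p) / (2 - p) = 12 - 8 * Real.sqrt 2 ↔ p = 2 - Real.sqrt 2 := by
  have h : 2 - p ≠ 0 := sub_ne_zero.2 hp.symm
  rw [eq_comm, ← sub_eq_zero, sub_dependence_coefficient_eq hp]
  simp [h, sub_eq_zero]

/-- Maximization of the dependence coefficient: for every `p ∈ [0,1]`,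
`4p(1−p)/(2−p) ≤ 12 − 8√2`, with equality iff `p = 2 − √2`; consequently the
maximum over `p ∈ [0,1]` of `(4p(1−p)/(2−p))·(3 − 2√2)` equals `68 − 48√2`,
attained at `p = 2 − √2`. -/
theorem dependence_coefficient_maximization :
    (∀ p ∈ Set.Icc (0 : ℝ) 1,
      4 * p * (1 - p) / (2 - p) ≤ 12 - 8 * Real.sqrt 2 ∧
      (4 * p * (1 - p) / (2 - p) = 12 - 8 * Real.sqrt 2 ↔ p = 2 - Real.sqrt 2)) ∧
    IsGreatest
      {y : ℝ | ∃ p ∈ Set.Icc (0 : ℝ) 1,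
        y = 4 * p * (1 - p) / (2 - p) * (3 - 2 * Real.sqrt 2)}
      (68 - 48 * Real.sqrt 2) ∧
    4 * (2 - Real.sqrt 2) * (1 - (2 - Real.sqrt 2)) / (2 - (2 - Real.sqrt 2)) *
        (3 - 2 * Real.sqrt 2) = 68 - 48 * Real.sqrt 2 := by
  have hs : Real.sqrt 2 ^ 2 = 2 := Real.sq_sqrt zero_le_two
  have hs0 : 0 < Real.sqrt 2 := Real.sqrt_pos.2 zero_lt_two
  have hprod : (12 - 8 * Real.sqrt 2) * (3 - 2 * Real.sqrt 2) = 68 - 48 * Real.sqrt 2 := by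
    linear_combination 16 * hs
  have hmem : 2 - Real.sqrt 2 ∈ Set.Icc (0 : ℝ) 1 := by
    constructor <;> nlinarith
  have hmax : 4 * (2 - Real.sqrt 2) * (1 - (2 - Real.sqrt 2)) / (2 - (2 - Real.sqrt 2)) *
      (3 - 2 * Real.sqrt 2) = 68 - 48 * Real.sqrt 2 := by
    rw [(dependence_coefficient_eq_iff (by linarith)).2 rfl, hprod]
  refine ⟨fun p hp => ?_, ⟨⟨_, hmem, hmax.symm⟩, ?_⟩, hmax⟩
  · have hp2 : p < 2 := hp.2.trans_lt one_lt_two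
    exact ⟨dependence_coefficient_le hp2, dependence_coefficient_eq_iff hp2.ne⟩
  · rintro _ ⟨p, hp, rfl⟩
    rw [← hprod]
    have hnonneg : 0 ≤ 3 - 2 * Real.sqrt 2 := by nlinarith [sq_nonneg (Real.sqrt 2 - 1)]
    exact mul_le_mul_of_nonneg_right
      (dependence_coefficient_le (hp.2.trans_lt one_lt_two)) hnonneg
end

section
/- Quantum models cannot violate Pearl's instrumental inequality: let ρ be a positive semidefinite complex matrix of trace 1 acting on ℂⁿ ⊗ ℂᵐ (an nm × nm matrix indexed by pairs), let M⁰ and M¹ be complex n × n matrices with 0 ≤ M⁰ ≤ I and 0 ≤ M¹ ≤ I (positive semidefinite and dominated by the identity in the Loewner order), and let N₀, N₁ be positive semidefinite m × m matrices with N₀ + N₁ = I. Then Re tr((M⁰ ⊗ N₀)·ρ) + Re tr((M¹ ⊗ N₁)·ρ) ≤ 1. -/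
open Matrix Kronecker
open scoped ComplexOrder

open scoped MatrixOrder Matrix.Norms.L2Operator in
/-- The trace of a product of two positive semidefinite matrices is nonnegative. -/
theorem Matrix.PosSemidef.trace_mul_nonneg {ι : Type*} [Fintype ι]
    {A B : Matrix ι ι ℂ} (hA : A.PosSemidef) (hB : B.PosSemidef) : 0 ≤ (A * B).trace := by
  classical
  obtain ⟨C, rfl⟩ := CStarAlgebra.nonneg_iff_eq_star_mul_self.mp hA.nonneg
  rw [star_eq_conjTranspose, Matrix.mul_assoc, Matrix.trace_mul_comm]
  exact (hB.mul_mul_conjTranspose_same C).trace_nonneg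

/-- Quantum models cannot violate Pearl's instrumental inequality: for a state `ρ`
on `ℂⁿ ⊗ ℂᵐ`, effects `0 ≤ M⁰, M¹ ≤ I` on the first factor and a POVM `N₀ + N₁ = I`
on the second factor,
`Re tr((M⁰ ⊗ N₀)ρ) + Re tr((M¹ ⊗ N₁)ρ) ≤ 1`. -/
theorem quantum_cannot_violate_pearl
    (n m : ℕ)
    (ρ : Matrix (Fin n × Fin m) (Fin n × Fin m) ℂ)
    (hρ : ρ.PosSemidef) (hρtr : ρ.trace = 1)
    (M0 M1 : Matrix (Fin n) (Fin n) ℂ)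
    (hM0 : M0.PosSemidef) (hM0le : (1 - M0).PosSemidef)
    (hM1 : M1.PosSemidef) (hM1le : (1 - M1).PosSemidef)
    (N0 N1 : Matrix (Fin m) (Fin m) ℂ)
    (hN0 : N0.PosSemidef) (hN1 : N1.PosSemidef) (hN : N0 + N1 = 1) :
    ((M0 ⊗ₖ N0 * ρ).trace).re + ((M1 ⊗ₖ N1 * ρ).trace).re ≤ 1 := by
  have h0 := (hM0le.kronecker hN0).trace_mul_nonneg hρ
  have h1 := (hM1le.kronecker hN1).trace_mul_nonneg hρ
  have hsum : (1 - M0) ⊗ₖ N0 + (1 - M1) ⊗ₖ N1 = 1 - M0 ⊗ₖ N0 - M1 ⊗ₖ N1 := by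
    have h_one : (1 : Matrix (Fin n) (Fin n) ℂ) ⊗ₖ N0 + 1 ⊗ₖ N1 = 1 := by
      rw [← kronecker_add, hN, one_kronecker_one]
    have h_sub (M : Matrix (Fin n) (Fin n) ℂ) (N : Matrix (Fin m) (Fin m) ℂ) :
        (1 - M) ⊗ₖ N = 1 ⊗ₖ N - M ⊗ₖ N := by
      rw [eq_sub_iff_add_eq, ← add_kronecker, sub_add_cancel]
    rw [h_sub, h_sub, ← h_one]
    abel
  have h := add_nonneg h0 h1
  rw [← trace_add, ← Matrix.add_mul, hsum, Matrix.sub_mul, Matrix.sub_mul, Matrix.one_mul,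
    trace_sub, trace_sub, hρtr] at h
  have hre := (Complex.le_def.mp h).1
  simp only [Complex.zero_re, Complex.sub_re, Complex.one_re] at hre
  linarith
end

section
/- Existence of a quantum violation of the Balke–Pearl causal bound: there exist a positive semidefinite 4 × 4 complex matrix ρ of trace 1 (a state on ℂ² ⊗ ℂ²) and 2 × 2 positive semidefinite matrices M^x_a (x,a ∈ {0,1}) with M^x_0 + M^x_1 = I and N^a_b (a,b ∈ {0,1}) with N^a_0 + N^a_1 = I such that, defining p(a,b|x) = Re tr((M^x_a ⊗ N^a_b)·ρ) and p(b|do(a)) = Re tr((I ⊗ N^a_b)·ρ), one has 2·p(0,0|0) + p(1,1|0) + p(0,1|1) + p(1,1|1) − 2 − max_{a,a',b ∈ {0,1}} |p(b|do(a)) − p(b|do(a'))| ≥ 3 − 2·√2. -/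
open Matrix Kronecker
open scoped ComplexOrder

/-- The real qubit matrix `(1 + x Z + y X) / 2`, a rank-one projector when `x² + y² = 1`. -/
noncomputable def realQubitMatrix (x y : ℝ) : Matrix (Fin 2) (Fin 2) ℂ :=
  !![(1 + x) / 2, y / 2; y / 2, (1 - x) / 2]

theorem realQubitMatrix_posSemidef {x y : ℝ} (h : x ^ 2 + y ^ 2 = 1) :
    (realQubitMatrix x y).PosSemidef := by
  have h' : (x : ℂ) ^ 2 + (y : ℂ) ^ 2 = 1 := by exact_mod_cast h
  have h2 : (starRingEnd ℂ) 2 = 2 := map_ofNat _ 2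
  have key : realQubitMatrix x y = (realQubitMatrix x y)ᴴ * realQubitMatrix x y := by
    ext i j
    fin_cases i <;> fin_cases j <;>
      simp [realQubitMatrix, Matrix.mul_apply, Fin.sum_univ_two, h2] <;> grind
  rw [key]
  exact Matrix.posSemidef_conjTranspose_mul_self _

theorem realQubitMatrix_add_neg (x y : ℝ) :
    realQubitMatrix x y + realQubitMatrix (-x) (-y) = 1 := by
  ext i j
  fin_cases i <;> fin_cases j <;> simp [realQubitMatrix] <;> ring

/-- The isometry `|i⟩ ↦ |ii⟩`. -/
def copyIsometry : Matrix (Fin 2 × Fin 2) (Fin 2) ℂ :=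
  Matrix.of fun i j => if i = (j, j) then 1 else 0

/-- The image of a real qubit matrix under `|i⟩ ↦ |ii⟩`. -/
noncomputable def schmidtState (u v : ℝ) : Matrix (Fin 2 × Fin 2) (Fin 2 × Fin 2) ℂ :=
  copyIsometry * realQubitMatrix u v * copyIsometryᴴ

theorem schmidtState_posSemidef {u v : ℝ} (h : u ^ 2 + v ^ 2 = 1) :
    (schmidtState u v).PosSemidef :=
  (realQubitMatrix_posSemidef h).mul_mul_conjTranspose_same _

theorem schmidtState_trace (u v : ℝ) : (schmidtState u v).trace = 1 := by
  simp [schmidtState, copyIsometry, realQubitMatrix, Matrix.trace, Matrix.mul_apply,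
    Fintype.sum_prod_type, Fin.sum_univ_two]
  ring

theorem re_trace_kronecker_schmidtState (x y x' y' u v : ℝ) :
    ((realQubitMatrix x y ⊗ₖ realQubitMatrix x' y' * schmidtState u v).trace).re =
      (1 + u * (x + x') + x * x' + v * (y * y')) / 4 := by
  have h : (realQubitMatrix x y ⊗ₖ realQubitMatrix x' y' * schmidtState u v).trace =
      ((1 + u * (x + x') + x * x' + v * (y * y')) / 4 : ℝ) := by
    simp [schmidtState, copyIsometry, realQubitMatrix, Matrix.trace, Matrix.mul_apply,
      Fintype.sum_prod_type, Fin.sum_univ_two]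
    ring
  rw [h, Complex.ofReal_re]

theorem re_trace_one_kronecker_schmidtState (x y u v : ℝ) :
    (((1 : Matrix (Fin 2) (Fin 2) ℂ) ⊗ₖ realQubitMatrix x y * schmidtState u v).trace).re =
      (1 + u * x) / 2 := by
  rw [← realQubitMatrix_add_neg 0 0, Matrix.add_kronecker, Matrix.add_mul, Matrix.trace_add,
    Complex.add_re, re_trace_kronecker_schmidtState, re_trace_kronecker_schmidtState]
  ring

/-- Bloch parameters attaining the violation: `(c, ±s)` for the second party, `(a, b)` for the
first setting of the first party and `(u, v)` for the state. -/
theorem exists_bloch_parameters :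
    ∃ c s u v a b : ℝ, c ^ 2 + s ^ 2 = 1 ∧ u ^ 2 + v ^ 2 = 1 ∧ a ^ 2 + b ^ 2 = 1 ∧
      a * (u + 3 * c) + b * (v * s) + 2 * (v * s) - u * c = 15 - 8 * √2 := by
  have hr : √2 ^ 2 = 2 := Real.sq_sqrt (by norm_num)
  have hr0 : 0 ≤ √2 := Real.sqrt_nonneg 2
  set r := √2
  have hr1 : 1 < r := by nlinarith
  have hr2 : r < 2 := by nlinarith
  have hc : √((2 * r - 1) / 3) ^ 2 = (2 * r - 1) / 3 := Real.sq_sqrt (by linarith)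
  have hs : √((4 - 2 * r) / 3) ^ 2 = (4 - 2 * r) / 3 := Real.sq_sqrt (by linarith)
  have hc0 : 0 < √((2 * r - 1) / 3) := Real.sqrt_pos.2 (by linarith)
  have hs0 : 0 < √((4 - 2 * r) / 3) := Real.sqrt_pos.2 (by linarith)
  set c := √((2 * r - 1) / 3)
  set s := √((4 - 2 * r) / 3)
  obtain ⟨u, hu⟩ : ∃ u, u * c = (8 * r - 11) / 3 := ⟨_, div_mul_cancel₀ _ hc0.ne'⟩
  obtain ⟨v, hv⟩ : ∃ v, v * s = (16 - 10 * r) / 3 := ⟨_, div_mul_cancel₀ _ hs0.ne'⟩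
  have hu2 : u ^ 2 * ((2 * r - 1) / 3) = ((8 * r - 11) / 3) ^ 2 := by rw [← hu, ← hc]; ring
  have hv2 : v ^ 2 * ((4 - 2 * r) / 3) = ((16 - 10 * r) / 3) ^ 2 := by rw [← hv, ← hs]; ring
  have hu3 : u ^ 2 = (46 * r - 65) / 3 :=
    mul_right_cancel₀ (b := (2 * r - 1) / 3) (by linarith)
      (by linear_combination hu2 - 28 / 9 * hr)
  have hv3 : v ^ 2 = (68 - 46 * r) / 3 :=
    mul_right_cancel₀ (b := (4 - 2 * r) / 3) (by linarith)
      (by linear_combination hv2 + 8 / 9 * hr)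
  obtain ⟨R, hRr⟩ : ∃ R, R = (2 + 4 * r) / 3 := ⟨_, rfl⟩
  have hR : R ≠ 0 := by linarith
  have hsum : (u + 3 * c) ^ 2 + (v * s) ^ 2 = R ^ 2 := by
    rw [hv, hRr]
    linear_combination hu3 + 6 * hu + 9 * hc + 28 / 3 * hr
  refine ⟨c, s, u, v, (u + 3 * c) / R, v * s / R, by linarith, by linarith, ?_, ?_⟩
  · rw [div_pow, div_pow, ← add_div, hsum, div_self (pow_ne_zero 2 hR)]
  · have h : (u + 3 * c) / R * (u + 3 * c) + v * s / R * (v * s) = R := by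
      rw [div_mul_eq_mul_div, div_mul_eq_mul_div, ← add_div, ← sq, ← sq, hsum, sq,
        mul_div_cancel_right₀ _ hR]
    linear_combination h + hRr + 2 * hv - hu

/-- Existence of a quantum violation of the Balke–Pearl causal bound: there exist a
two-qubit state `ρ` and binary POVMs `M^x` (on the first factor) and `N^a` (on the
second factor) such that, with `p(a,b|x) = Re tr((M^x_a ⊗ N^a_b)ρ)` and
`p(b|do(a)) = Re tr((I ⊗ N^a_b)ρ)`, the Balke–Pearl expression
`2 p(0,0|0) + p(1,1|0) + p(0,1|1) + p(1,1|1) − 2` exceeds the quantum average causal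
effect `max_{a,a',b} |p(b|do(a)) − p(b|do(a'))|` by at least `3 − 2√2`. -/
theorem quantum_violation_balke_pearl :
    ∃ (ρ : Matrix (Fin 2 × Fin 2) (Fin 2 × Fin 2) ℂ)
      (M : Fin 2 → Fin 2 → Matrix (Fin 2) (Fin 2) ℂ)
      (N : Fin 2 → Fin 2 → Matrix (Fin 2) (Fin 2) ℂ),
      ρ.PosSemidef ∧ ρ.trace = 1 ∧
      (∀ x a, (M x a).PosSemidef) ∧ (∀ x, M x 0 + M x 1 = 1) ∧
      (∀ a b, (N a b).PosSemidef) ∧ (∀ a, N a 0 + N a 1 = 1) ∧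
      (let p : Fin 2 → Fin 2 → Fin 2 → ℝ :=
         fun a b x => ((M x a ⊗ₖ N a b * ρ).trace).re
       let pdo : Fin 2 → Fin 2 → ℝ :=
         fun b a => (((1 : Matrix (Fin 2) (Fin 2) ℂ) ⊗ₖ N a b * ρ).trace).re
       3 - 2 * Real.sqrt 2 ≤
         2 * p 0 0 0 + p 1 1 0 + p 0 1 1 + p 1 1 1 - 2 -
           Finset.univ.sup' Finset.univ_nonempty
             (fun t : Fin 2 × Fin 2 × Fin 2 => |pdo t.2.2 t.1 - pdo t.2.2 t.2.1|)) := by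
  obtain ⟨c, s, u, v, a, b, hcs, huv, hab, hS⟩ := exists_bloch_parameters
  refine ⟨schmidtState u v,
    ![![realQubitMatrix a b, realQubitMatrix (-a) (-b)],
      ![realQubitMatrix 0 (-1), realQubitMatrix (-0) (- -1)]],
    ![![realQubitMatrix c s, realQubitMatrix (-c) (-s)],
      ![realQubitMatrix c (-s), realQubitMatrix (-c) (- -s)]],
    schmidtState_posSemidef huv, schmidtState_trace u v, ?_, ?_, ?_, ?_, ?_⟩
  · intro x i
    fin_cases x <;> fin_cases i <;> exact realQubitMatrix_posSemidef (by linarith)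
  · intro x
    fin_cases x <;> exact realQubitMatrix_add_neg _ _
  · intro x i
    fin_cases x <;> fin_cases i <;> exact realQubitMatrix_posSemidef (by linarith)
  · intro x
    fin_cases x <;> exact realQubitMatrix_add_neg _ _
  · intro p pdo
    have hdo : ∀ i j k, pdo k i = pdo k j := by
      intro i j k
      fin_cases i <;> fin_cases j <;> fin_cases k <;>
        simp [pdo, re_trace_one_kronecker_schmidtState]
    have hsup : Finset.univ.sup' Finset.univ_nonempty
        (fun t : Fin 2 × Fin 2 × Fin 2 => |pdo t.2.2 t.1 - pdo t.2.2 t.2.1|) ≤ 0 :=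
      Finset.sup'_le _ _ fun t _ => by rw [hdo t.1 t.2.1, sub_self, abs_zero]
    have h₀₀₀ : p 0 0 0 = (1 + u * (a + c) + a * c + v * (b * s)) / 4 :=
      re_trace_kronecker_schmidtState ..
    have h₁₁₀ : p 1 1 0 = (1 + u * (-a + -c) + -a * -c + v * (-b * - -s)) / 4 :=
      re_trace_kronecker_schmidtState ..
    have h₀₁₁ : p 0 1 1 = (1 + u * (0 + -c) + 0 * -c + v * (-1 * -s)) / 4 :=
      re_trace_kronecker_schmidtState ..
    have h₁₁₁ : p 1 1 1 = (1 + u * (-0 + -c) + -0 * -c + v * (- -1 * - -s)) / 4 :=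
      re_trace_kronecker_schmidtState ..
    rw [h₀₀₀, h₁₁₀, h₀₁₁, h₁₁₁]
    linarith
end

section
/- Bonet's instrumental inequality: for every classical instrumental model with binary A, B and instrument X taking values in {0,1,2}, the observed conditional distribution satisfies p(0,1|0) − p(0,1|1) − p(1,1|1) − p(1,0|2) − p(0,1|2) ≤ 0. -/
/-- The pointwise form of Bonet's inequality: `u`, `v`, `w` are the probabilities of `A = 0` given
`X = 0, 1, 2`, and `s`, `t` are the probabilities of `B = 1` given `A = 0, 1`. -/
theorem bonet_pointwise {u v w s t : ℝ} (hu : u ≤ 1)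
    (hv0 : 0 ≤ v) (hv1 : v ≤ 1) (hw0 : 0 ≤ w) (hw1 : w ≤ 1)
    (hs0 : 0 ≤ s) (hs1 : s ≤ 1) (ht0 : 0 ≤ t) (ht1 : t ≤ 1) :
    u * s - v * s - (1 - v) * t - (1 - w) * (1 - t) - w * s ≤ 0 := by
  have hv := sub_nonneg.2 hv1
  have hw := sub_nonneg.2 hw1
  have h : 0 ≤ (1 - u) * s + v * w * s + v * (1 - w) * (1 - t) + (1 - v) * w * t
      + (1 - v) * (1 - w) * (1 - s) := by
    have := sub_nonneg.2 hu
    have := sub_nonneg.2 hs1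
    have := sub_nonneg.2 ht1
    positivity
  linarith

/-- Bonet's instrumental inequality: for every classical instrumental model with
binary `A`, `B` and instrument `X ∈ {0,1,2}`, the observed conditional distribution
satisfies `p(0,1|0) − p(0,1|1) − p(1,1|1) − p(1,0|2) − p(0,1|2) ≤ 0`. -/
theorem bonet_instrumental_inequality
    {Λ : Type*} [Fintype Λ]
    (μ : Λ → ℝ) (hμ0 : ∀ l, 0 ≤ μ l) (hμ1 : ∑ l, μ l = 1)
    (pA : Fin 2 → Fin 3 → Λ → ℝ)
    (hA0 : ∀ a x l, 0 ≤ pA a x l) (hA1 : ∀ x l, ∑ a, pA a x l = 1)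
    (pB : Fin 2 → Fin 2 → Λ → ℝ)
    (hB0 : ∀ b a l, 0 ≤ pB b a l) (hB1 : ∀ a l, ∑ b, pB b a l = 1)
    (p : Fin 2 → Fin 2 → Fin 3 → ℝ)
    (hp : ∀ a b x, p a b x = ∑ l, μ l * pA a x l * pB b a l) :
    p 0 1 0 - p 0 1 1 - p 1 1 1 - p 1 0 2 - p 0 1 2 ≤ 0 := by
  simp only [Fin.sum_univ_two] at hA1 hB1
  simp only [hp, ← Finset.sum_sub_distrib]
  refine Finset.sum_nonpos fun l _ => ?_
  have hA x : pA 1 x l = 1 - pA 0 x l := by linarith [hA1 x l]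
  have hB a : pB 0 a l = 1 - pB 1 a l := by linarith [hB1 a l]
  have hA_le x : pA 0 x l ≤ 1 := by linarith [hA1 x l, hA0 1 x l]
  have hB_le a : pB 1 a l ≤ 1 := by linarith [hB1 a l, hB0 0 a l]
  have h := mul_nonpos_of_nonneg_of_nonpos (hμ0 l) (bonet_pointwise (hA_le 0)
    (hA0 0 1 l) (hA_le 1) (hA0 0 2 l) (hA_le 2) (hB0 1 0 l) (hB_le 0) (hB0 1 1 l) (hB_le 1))
  rw [hA, hA, hB]
  linarith
end

section
/- Kedagni's instrumental inequality: for every classical instrumental model with binary A, B and instrument X taking values in {0,1,2,3}, the observed conditional distribution satisfies p(0,0|0) + p(1,0|0) − p(0,1|1) − p(1,0|1) − p(0,0|2) − p(1,0|2) − p(0,0|3) − p(1,1|3) ≤ 0. -/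
/-- The inequality for fixed hidden variable: `a i` is the probability of outcome `0` of `A` at
setting `i`, and `s`, `t` are the probabilities of outcome `0` of `B` given `A = 0`, `A = 1`. -/
theorem kedagni_pointwise (a : Fin 4 → ℝ) (ha0 : ∀ i, 0 ≤ a i) (ha1 : ∀ i, a i ≤ 1)
    {s t : ℝ} (hs0 : 0 ≤ s) (hs1 : s ≤ 1) (ht0 : 0 ≤ t) (ht1 : t ≤ 1) :
    a 0 * s + (1 - a 0) * t - a 1 * (1 - s) - (1 - a 1) * t - a 2 * s - (1 - a 2) * t
      - a 3 * s - (1 - a 3) * (1 - t) ≤ 0 := by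
  have h11 : 0 ≤ s * t * ((1 - a 1) + a 3) :=
    mul_nonneg (mul_nonneg hs0 ht0) (by linarith [ha1 1, ha0 3])
  have h00 : 0 ≤ (1 - s) * (1 - t) * (a 1 + (1 - a 3)) :=
    mul_nonneg (mul_nonneg (by linarith) (by linarith)) (by linarith [ha0 1, ha1 3])
  have h10 : 0 ≤ s * (1 - t) * (a 2 + (1 - a 0)) :=
    mul_nonneg (mul_nonneg hs0 (by linarith)) (by linarith [ha0 2, ha1 0])
  have h01 : 0 ≤ (1 - s) * t * (a 0 + (1 - a 2)) :=
    mul_nonneg (mul_nonneg (by linarith) ht0) (by linarith [ha0 0, ha1 2])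
  linarith

/-- Kedagni's instrumental inequality: for every classical instrumental model with
binary `A`, `B` and instrument `X ∈ {0,1,2,3}`, the observed conditional distribution
satisfies `p(0,0|0) + p(1,0|0) − p(0,1|1) − p(1,0|1) − p(0,0|2) − p(1,0|2) − p(0,0|3)
− p(1,1|3) ≤ 0`. -/
theorem kedagni_instrumental_inequality
    {Λ : Type*} [Fintype Λ]
    (μ : Λ → ℝ) (hμ0 : ∀ l, 0 ≤ μ l) (hμ1 : ∑ l, μ l = 1)
    (pA : Fin 2 → Fin 4 → Λ → ℝ)
    (hA0 : ∀ a x l, 0 ≤ pA a x l) (hA1 : ∀ x l, ∑ a, pA a x l = 1)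
    (pB : Fin 2 → Fin 2 → Λ → ℝ)
    (hB0 : ∀ b a l, 0 ≤ pB b a l) (hB1 : ∀ a l, ∑ b, pB b a l = 1)
    (p : Fin 2 → Fin 2 → Fin 4 → ℝ)
    (hp : ∀ a b x, p a b x = ∑ l, μ l * pA a x l * pB b a l) :
    p 0 0 0 + p 1 0 0 - p 0 1 1 - p 1 0 1 - p 0 0 2 - p 1 0 2 - p 0 0 3 - p 1 1 3 ≤ 0 := by
  simp only [hp, ← Finset.sum_add_distrib, ← Finset.sum_sub_distrib]
  refine Finset.sum_nonpos fun l _ => ?_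
  have hA (x : Fin 4) : pA 1 x l = 1 - pA 0 x l := by
    have := hA1 x l
    rw [Fin.sum_univ_two] at this
    linarith
  have hB (a : Fin 2) : pB 1 a l = 1 - pB 0 a l := by
    have := hB1 a l
    rw [Fin.sum_univ_two] at this
    linarith
  have key := kedagni_pointwise (fun x => pA 0 x l) (fun x => hA0 0 x l)
    (fun x => by linarith [hA x, hA0 1 x l]) (hB0 0 0 l) (by linarith [hB 0, hB0 1 0 l])
    (hB0 0 1 l) (by linarith [hB 1, hB0 1 1 l])
  simp only [hA, hB]
  linarith [mul_nonpos_of_nonneg_of_nonpos (hμ0 l) key]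
end
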